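/- Suppose f : ℝ^p → ℝ satisfies Assumption (KL-MR), and set ρ = β / max{θ(β+2), 1}. Then there exists C > 0 such that for every ε ∈ [0, ε̄] and every ε-biased gradient curve x : [0,∞) → ℝ^p of f with f(x(t)) ∈ vcrit_ε f for all t ≥ 0, one has dist(x(t), crit f) ≤ C ε^ρ for all t ≥ 0. -/

import Mathlib

open Filter MeasureTheory Metric Set Topology
open scoped ENNReal NNReal

abbrev Ep (p : ℕ) := EuclideanSpace ℝ (Fin p)

def critSet {p : ℕ} (f : Ep p → ℝ) (ε : ℝ) : Set (Ep p) := {x | ‖gradient f x‖ ≤ ε}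

def vcritSet {p : ℕ} (f : Ep p → ℝ) (ε : ℝ) : Set ℝ := f '' critSet f ε

/-- An `ε`-biased gradient curve of `f` on the interval `I ⊆ [0,∞)`: a locally Lipschitz
curve on `I` which is differentiable a.e. on `I` with `‖x'(t) + ∇f(x(t))‖ ≤ ε`. -/
def IsBiasedGradCurve {p : ℕ} (f : Ep p → ℝ) (ε : ℝ) (I : Set ℝ) (x : ℝ → Ep p) : Prop :=
  (∀ t ∈ I, ∃ K : NNReal, ∃ s ∈ nhdsWithin t I, LipschitzOnWith K x s) ∧
  ∀ᵐ t ∂(volume.restrict I), DifferentiableAt ℝ x t ∧ ‖deriv x t + gradient f (x t)‖ ≤ ε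

theorem LipschitzOnWith.sub_le_mul_of_deriv_le {φ : ℝ → ℝ} {K : ℝ≥0} {a b k : ℝ} (hab : a ≤ b)
    (hφ : LipschitzOnWith K φ (Icc a b))
    (hk : ∀ᵐ s ∂(volume.restrict (Icc a b)), deriv φ s ≤ k) :
    φ b - φ a ≤ k * (b - a) := by
  have hac : AbsolutelyContinuousOnInterval φ a b := by
    apply LipschitzOnWith.absolutelyContinuousOnInterval (K := K)
    rwa [uIcc_of_le hab]
  rw [← hac.integral_deriv_eq_sub]
  calc ∫ s in a..b, deriv φ s ≤ ∫ _ in a..b, k :=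
        intervalIntegral.integral_mono_ae_restrict hab hac.intervalIntegrable_deriv
          intervalIntegrable_const hk
    _ = k * (b - a) := by simp [mul_comm]

theorem LipschitzOnWith.norm_sub_le_mul_of_norm_deriv_le {E : Type*} [NormedAddCommGroup E]
    [InnerProductSpace ℝ E] {x : ℝ → E} {K : ℝ≥0} {a b k : ℝ} (hab : a ≤ b)
    (hx : LipschitzOnWith K x (Icc a b))
    (hk : ∀ᵐ s ∂(volume.restrict (Icc a b)), DifferentiableAt ℝ x s ∧ ‖deriv x s‖ ≤ k) :
    ‖x b - x a‖ ≤ k * (b - a) := by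
  set v := x b - x a with hv
  rcases (norm_nonneg v).eq_or_lt with h0 | hpos
  · rw [← h0]
    have h := (lipschitzOnWith_iff_norm_sub_le.1 hx) (left_mem_Icc.2 hab) (left_mem_Icc.2 hab)
    by_contra! hneg
    have hab' : a < b := by
      rcases hab.eq_or_lt with h | h
      · simp [h] at hneg
      · exact h
    have hk0 : k < 0 := by
      by_contra! hk0
      nlinarith
    have hvol : volume.restrict (Icc a b) ≠ 0 := by
      simp [hab']
    have : (ae (volume.restrict (Icc a b))).NeBot := ae_neBot.2 hvol
    obtain ⟨s, -, hs⟩ := hk.exists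
    linarith [norm_nonneg (deriv x s)]
  · have hlip : LipschitzOnWith (‖innerSL ℝ v‖₊ * K) (fun s => innerSL ℝ v (x s)) (Icc a b) :=
      (innerSL ℝ v).lipschitz.comp_lipschitzOnWith hx
    have h := hlip.sub_le_mul_of_deriv_le hab (k := ‖v‖ * k) (by
      filter_upwards [hk] with s ⟨hd, hs⟩
      have hder : HasDerivAt (fun s => innerSL ℝ v (x s)) (innerSL ℝ v (deriv x s)) s :=
        (innerSL ℝ v).hasFDerivAt.comp_hasDerivAt s hd.hasDerivAt
      rw [hder.deriv, innerSL_apply_apply]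
      exact (real_inner_le_norm _ _).trans (by gcongr))
    rw [← map_sub, ← hv, innerSL_apply_apply, real_inner_self_eq_norm_mul_norm, mul_assoc] at h
    exact le_of_mul_le_mul_left h hpos

theorem sub_le_of_infDist_finite_le {g : ℝ → ℝ} {a b r : ℝ} {V : Set ℝ} (hab : a ≤ b)
    (hg : ContinuousOn g (Icc a b)) (hV : V.Finite) (hne : V.Nonempty)
    (hr : ∀ s ∈ Icc a b, infDist (g s) V ≤ r) :
    g a - g b ≤ V.ncard * (2 * r) := by
  have hr0 : 0 ≤ r := infDist_nonneg.trans (hr a (left_mem_Icc.2 hab))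
  have hsub : Icc (g b) (g a) ⊆ ⋃ v ∈ hV.toFinset, closedBall v r := by
    intro y hy
    obtain ⟨s, hs, rfl⟩ := intermediate_value_Icc' hab hg hy
    obtain ⟨v, hv, hd⟩ := hV.isCompact.exists_infDist_eq_dist hne (g s)
    simp only [mem_iUnion, mem_closedBall, Finite.mem_toFinset]
    exact ⟨v, hv, hd ▸ hr s hs⟩
  have hvol := (measure_mono (μ := volume) hsub).trans (measure_biUnion_finset_le _ _)
  simp only [Real.volume_Icc, Real.volume_closedBall, Finset.sum_const, nsmul_eq_mul] at hvol
  rw [← ENNReal.ofReal_natCast, ← ENNReal.ofReal_mul (by positivity),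
    ENNReal.ofReal_le_ofReal_iff (by positivity)] at hvol
  rwa [ncard_eq_toFinset_card V hV]

theorem LipschitzWith.norm_gradient_le {E : Type*} [NormedAddCommGroup E]
    [InnerProductSpace ℝ E] [CompleteSpace E] {f : E → ℝ} {L : ℝ≥0} (hf : LipschitzWith L f)
    (y : E) : ‖gradient f y‖ ≤ L := by
  rw [gradient, LinearIsometryEquiv.norm_map]
  exact norm_fderiv_le_of_lipschitz ℝ hf

theorem critSet_mono {p : ℕ} (f : Ep p → ℝ) {ε δ : ℝ} (h : ε ≤ δ) : critSet f ε ⊆ critSet f δ :=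
  fun _ hy => le_trans hy h

theorem vcritSet_mono {p : ℕ} (f : Ep p → ℝ) {ε δ : ℝ} (h : ε ≤ δ) :
    vcritSet f ε ⊆ vcritSet f δ :=
  image_mono (critSet_mono f h)

theorem IsBiasedGradCurve.exists_lipschitzOnWith {p : ℕ} {f : Ep p → ℝ} {ε : ℝ} {I : Set ℝ}
    {x : ℝ → Ep p} (hx : IsBiasedGradCurve f ε I x) {a b : ℝ} (h : Icc a b ⊆ I) :
    ∃ K, LipschitzOnWith K x (Icc a b) := by
  refine LocallyLipschitzOn.exists_lipschitzOnWith_of_compact isCompact_Icc ?_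
  intro t ht
  obtain ⟨K, s, hs, hK⟩ := hx.1 t (h ht)
  exact ⟨K, s, nhdsWithin_mono t h hs, hK⟩

theorem IsBiasedGradCurve.norm_sub_le {p : ℕ} {f : Ep p → ℝ} {L : ℝ≥0} {ε : ℝ} {I : Set ℝ}
    {x : ℝ → Ep p} (hx : IsBiasedGradCurve f ε I x) (hf : LipschitzWith L f) {a b : ℝ}
    (hab : a ≤ b) (h : Icc a b ⊆ I) : ‖x b - x a‖ ≤ (L + ε) * (b - a) := by
  obtain ⟨K, hK⟩ := hx.exists_lipschitzOnWith h
  refine hK.norm_sub_le_mul_of_norm_deriv_le hab ?_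
  filter_upwards [ae_restrict_of_ae_restrict_of_subset h hx.2] with s ⟨hd, hs⟩
  refine ⟨hd, ?_⟩
  have h1 := _root_.norm_sub_le (deriv x s + gradient f (x s)) (gradient f (x s))
  rw [add_sub_cancel_right] at h1
  linarith [hf.norm_gradient_le (x s)]

theorem IsBiasedGradCurve.sub_le_of_le_norm_gradient {p : ℕ} {f : Ep p → ℝ}
    (hf : Differentiable ℝ f) {L : ℝ≥0} (hfL : LipschitzWith L f) {ε g : ℝ} {I : Set ℝ}
    {x : ℝ → Ep p} (hx : IsBiasedGradCurve f ε I x) {a b : ℝ}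
    (hab : a ≤ b) (h : Icc a b ⊆ I) (hε : 0 ≤ ε) (hg : 2 * ε ≤ g)
    (hgrad : ∀ s ∈ Icc a b, g ≤ ‖gradient f (x s)‖) :
    f (x b) - f (x a) ≤ -(g ^ 2 / 2) * (b - a) := by
  obtain ⟨K, hK⟩ := hx.exists_lipschitzOnWith h
  refine (hfL.comp_lipschitzOnWith hK).sub_le_mul_of_deriv_le hab ?_
  filter_upwards [ae_restrict_of_ae_restrict_of_subset h hx.2,
    ae_restrict_mem measurableSet_Icc] with s ⟨hd, hs⟩ hsI
  have hder : HasDerivAt (f ∘ x) (fderiv ℝ f (x s) (deriv x s)) s :=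
    (hf (x s)).hasFDerivAt.comp_hasDerivAt s hd.hasDerivAt
  have hG := hgrad s hsI
  rw [hder.deriv, ← toDual_gradient, InnerProductSpace.toDual_apply_apply]
  have h1 := real_inner_le_norm (gradient f (x s)) (deriv x s + gradient f (x s))
  rw [inner_add_right, real_inner_self_eq_norm_mul_norm] at h1
  have h2 := mul_le_mul_of_nonneg_left hs (norm_nonneg (gradient f (x s)))
  nlinarith

theorem stmt5 {p : ℕ} (f : Ep p → ℝ) (hf : ContDiff ℝ 1 f)
    (L : ℝ≥0) (hL : 0 < L) (hLip : LipschitzWith L f)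
    (hvc_ne : (vcritSet f 0).Nonempty) (hvc_fin : (vcritSet f 0).Finite)
    (εb : ℝ) (hεb0 : 0 < εb) (hεb1 : εb < 1)
    (hsegs : ∀ ε : ℝ, 0 ≤ ε → ε ≤ εb → ∃ (n : ℕ) (a b : Fin n → ℝ),
      vcritSet f ε = ⋃ i, Set.Icc (a i) (b i))
    (c θ β : ℝ) (hc : 0 < c) (hθ0 : 0 ≤ θ) (hθ1 : θ < 1) (hβ : 0 < β)
    (hKL : ∀ y : Ep p, f y ∈ vcritSet f εb →
      (infDist (f y) (vcritSet f 0)) ^ θ ≤ c * ‖gradient f y‖)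
    (hMR : ∀ y : Ep p, f y ∈ vcritSet f εb →
      infDist y (critSet f 0) ≤ c * ‖gradient f y‖ ^ β)
    (ρ : ℝ) (hρ : ρ = β / max (θ * (β + 2)) 1)
    :
    ∃ C : ℝ, 0 < C ∧ ∀ ε : ℝ, 0 ≤ ε → ε ≤ εb →
      ∀ x : ℝ → Ep p, IsBiasedGradCurve f ε (Set.Ici 0) x →
        (∀ t : ℝ, 0 ≤ t → f (x t) ∈ vcritSet f ε) →
        ∀ t : ℝ, 0 ≤ t → infDist (x t) (critSet f 0) ≤ C * ε ^ ρ := by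
  -- At a critical point the inequality reads `0 ^ θ ≤ 0`, which excludes `θ = 0`.
  have hθ : 0 < θ := by
    refine hθ0.lt_of_ne' fun h => ?_
    obtain ⟨_, y, hy, rfl⟩ := hvc_ne
    have h1 := hKL y (mem_image_of_mem f (critSet_mono f hεb0.le hy))
    have hy' : ‖gradient f y‖ ≤ 0 := hy
    rw [h, Real.rpow_zero] at h1
    nlinarith
  have hρ0 : 0 < ρ := by rw [hρ]; positivity
  have hρβ : ρ ≤ β := by
    rw [hρ]
    exact div_le_self hβ.le (le_max_right _ _)
  have hρq : ρ ≤ 1 / θ * (2 / β + 1)⁻¹ := by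
    have : 1 / θ * (2 / β + 1)⁻¹ = β / (θ * (β + 2)) := by
      field_simp
      ring
    rw [this, hρ]
    exact div_le_div_of_nonneg_left hβ.le (by positivity) (le_max_left _ _)
  set q := 2 / β + 1 with hq
  have hq0 : 0 < q := by positivity
  set V := vcritSet f 0 with hV
  set A : ℝ := 4 * V.ncard * (L + 1) / c * (2 * c ^ (1 / θ)) with hA
  have hA0 : 0 ≤ A := by positivity
  refine ⟨2 * c * A ^ q⁻¹ + 2 * c * 2 ^ β, by positivity, ?_⟩
  intro ε hε0 hε1 x hx hfx t ht
  set D := infDist (x t) (critSet f 0) with hD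
  have hD0 : 0 ≤ D := infDist_nonneg
  set u := D / (2 * c) with hu
  have hu0 : 0 ≤ u := by positivity
  have hDu : D = 2 * c * u := by rw [hu]; field_simp
  have hεpow : ∀ e, ρ ≤ e → ε ^ e ≤ ε ^ ρ := fun e he =>
    Real.rpow_le_rpow_of_exponent_ge' hε0 (hε1.trans hεb1.le) hρ0.le he
  suffices h : u ≤ A ^ q⁻¹ * ε ^ ρ ∨ u ≤ 2 ^ β * ε ^ ρ by
    have h1 : 0 ≤ A ^ q⁻¹ * ε ^ ρ := by positivity
    have h2 : 0 ≤ 2 ^ β * ε ^ ρ := by positivity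
    have h3 : u ≤ A ^ q⁻¹ * ε ^ ρ + 2 ^ β * ε ^ ρ := by rcases h with h | h <;> linarith
    calc D = 2 * c * u := hDu
      _ ≤ 2 * c * (A ^ q⁻¹ * ε ^ ρ + 2 ^ β * ε ^ ρ) := by gcongr
      _ = _ := by ring
  rcases le_or_gt (u ^ β⁻¹) (2 * ε) with hcase | hcase
  · right
    calc u ≤ (2 * ε) ^ β := (Real.rpow_inv_le_iff_of_pos hu0 (by positivity) hβ).1 hcase
      _ = 2 ^ β * ε ^ β := Real.mul_rpow (by norm_num) hε0
      _ ≤ 2 ^ β * ε ^ ρ := mul_le_mul_of_nonneg_left (hεpow β hρβ) (by positivity)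
  left
  set τ := D / (2 * (L + 1)) with hτ
  have hτ0 : 0 ≤ τ := by positivity
  have hIcc : Icc t (t + τ) ⊆ Ici 0 := fun s hs => ht.trans hs.1
  have hfxb : ∀ s, 0 ≤ s → f (x s) ∈ vcritSet f εb := fun s hs => vcritSet_mono f hε1 (hfx s hs)
  have hgrad : ∀ s ∈ Icc t (t + τ), u ^ β⁻¹ ≤ ‖gradient f (x s)‖ := by
    intro s hs
    have h1 := hx.norm_sub_le hLip hs.1 ((Icc_subset_Icc_right hs.2).trans hIcc)
    have h2 : D ≤ infDist (x s) (critSet f 0) + dist (x t) (x s) := infDist_le_infDist_add_dist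
    rw [dist_eq_norm, norm_sub_rev] at h2
    have h3 : (L + ε) * (s - t) ≤ (L + 1) * τ := by
      have := hs.1
      have := hs.2
      gcongr <;> linarith
    have h4 : (L + 1) * τ = D / 2 := by rw [hτ]; field_simp
    have h5 := hMR (x s) (hfxb s (hIcc hs))
    rw [Real.rpow_inv_le_iff_of_pos hu0 (norm_nonneg _) hβ]
    refine le_of_mul_le_mul_left ?_ hc
    linarith
  have hdec := hx.sub_le_of_le_norm_gradient (hf.differentiable one_ne_zero) hLip
    (le_add_of_nonneg_right hτ0) hIcc hε0 hcase.le hgrad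
  have hcont : ContinuousOn (fun s => f (x s)) (Icc t (t + τ)) := by
    obtain ⟨K, hK⟩ := hx.exists_lipschitzOnWith hIcc
    exact hLip.continuous.comp_continuousOn hK.continuousOn
  have hosc : f (x t) - f (x (t + τ)) ≤ V.ncard * (2 * (c * ε) ^ (1 / θ)) := by
    refine sub_le_of_infDist_finite_le (le_add_of_nonneg_right hτ0) hcont hvc_fin hvc_ne ?_
    intro s hs
    obtain ⟨y, hy, hys⟩ := hfx s (hIcc hs)
    have h1 := hKL y (hys ▸ hfxb s (hIcc hs))
    rw [← hys, one_div, Real.le_rpow_inv_iff_of_pos infDist_nonneg (by positivity) hθ]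
    have hy' : ‖gradient f y‖ ≤ ε := hy
    exact h1.trans (by gcongr)
  have hpow : (u ^ β⁻¹) ^ 2 * u = u ^ q := by
    rw [hq, ← Real.rpow_mul_natCast hu0, Real.rpow_add_one' hu0 (by positivity)]
    congr 2
    push_cast
    ring
  have hmain : u ^ q ≤ A * ε ^ (1 / θ) := by
    rw [add_sub_cancel_left] at hdec
    rw [Real.mul_rpow hc.le hε0] at hosc
    have h1 : (u ^ β⁻¹) ^ 2 / 2 * τ ≤ V.ncard * (2 * (c ^ (1 / θ) * ε ^ (1 / θ))) := by linarith
    have h2 : (u ^ β⁻¹) ^ 2 / 2 * τ = u ^ q * (c / (2 * (L + 1))) := by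
      rw [← hpow, hτ, hDu]
      field_simp
    rw [h2, ← le_div_iff₀ (by positivity)] at h1
    refine h1.trans ?_
    have h3 : V.ncard * (2 * (c ^ (1 / θ) * ε ^ (1 / θ))) / (c / (2 * (L + 1)))
        = A * ε ^ (1 / θ) / 2 := by
      rw [hA]
      field_simp
      ring
    rw [h3]
    have : 0 ≤ A * ε ^ (1 / θ) := by positivity
    linarith
  calc u ≤ (A * ε ^ (1 / θ)) ^ q⁻¹ := (Real.le_rpow_inv_iff_of_pos hu0 (by positivity) hq0).2 hmain
    _ = A ^ q⁻¹ * ε ^ (1 / θ * q⁻¹) := by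
      rw [Real.mul_rpow hA0 (by positivity), ← Real.rpow_mul hε0]
    _ ≤ A ^ q⁻¹ * ε ^ ρ := mul_le_mul_of_nonneg_left (hεpow _ hρq) (by positivity)
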